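/- arXiv:2604.26730 — 2 statements merged into one kernel-verified Lean document; each statement's English description precedes it below -/
import Mathlib

section
/- Let G be a group equipped with a T0 Alexandroff topology making G a paratopological group (multiplication continuous). If G is compact and is not connected as a topological space, then the topology of G is the discrete topology. -/
/-- A T0 compact space with a group structure for which left translations are continuous is T1:
it has a closed point, and translations are homeomorphisms. -/
theorem t1Space_of_compactSpace_of_continuousMul (G : Type*) [Group G] [TopologicalSpace G]
    [T0Space G] [ContinuousMul G] [CompactSpace G] : T1Space G := by
  obtain ⟨x, -, hx⟩ :=
    (isClosed_univ (X := G)).exists_closed_singleton Set.univ_nonempty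
  refine ⟨fun y ↦ ?_⟩
  simpa using (Homeomorph.mulLeft (y * x⁻¹)).isClosed_image.mpr hx

/-- A T1 Alexandroff space is discrete. -/
theorem discreteTopology_of_alexandrovDiscrete_of_t1Space (X : Type*) [TopologicalSpace X]
    [AlexandrovDiscrete X] [T1Space X] : DiscreteTopology X := by
  refine discreteTopology_iff_forall_isClosed.mpr fun s ↦ ?_
  rw [← Set.biUnion_of_singleton s]
  exact isClosed_iUnion fun x ↦ isClosed_iUnion fun _ ↦ isClosed_singleton

/-- A compact non-connected Alexandroff paratopological group carries the discrete topology. -/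
theorem alexandroff_paratopological_group_compact_not_connected_discrete
    (G : Type*) [Group G] [TopologicalSpace G] [AlexandrovDiscrete G] [T0Space G]
    [ContinuousMul G] [CompactSpace G] (h : ¬ ConnectedSpace G) :
    DiscreteTopology G := by
  have := t1Space_of_compactSpace_of_continuousMul G
  exact discreteTopology_of_alexandrovDiscrete_of_t1Space G
end

section
/- Let G be a connected, non-compact group equipped with a T0 Alexandroff topology making G a paratopological group (multiplication continuous). Then G has no proper open subgroups and no proper closed subgroups: if H is a subgroup of G whose underlying set is open, then H = G, and likewise if the underlying set of H is closed, then H = G. -/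
/-- In a group with continuous multiplication, inversion reverses specialization. -/
theorem Specializes.inv_swap {G : Type*} [Group G] [TopologicalSpace G] [ContinuousMul G]
    {x y : G} (h : x ⤳ y) : y⁻¹ ⤳ x⁻¹ := by
  have hmap : Continuous fun z : G => x⁻¹ * z * y⁻¹ := by fun_prop
  simpa using h.map hmap

/-- In an Alexandroff paratopological group, closed subgroups are open. -/
theorem Subgroup.isOpen_of_isClosed {G : Type*} [Group G] [TopologicalSpace G]
    [AlexandrovDiscrete G] [ContinuousMul G] (H : Subgroup G) (hH : IsClosed (H : Set G)) :
    IsOpen (H : Set G) :=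
  isOpen_iff_forall_specializes.2 fun _ _ hxy hy =>
    H.inv_mem_iff.1 (hxy.inv_swap.mem_closed hH (H.inv_mem hy))

/-- A connected group with continuous multiplication has no proper open subgroup. -/
theorem Subgroup.eq_top_of_isOpen {G : Type*} [Group G] [TopologicalSpace G]
    [ContinuousMul G] [ConnectedSpace G] (H : Subgroup G) (hH : IsOpen (H : Set G)) :
    H = ⊤ :=
  SetLike.coe_injective (IsClopen.eq_univ ⟨H.isClosed_of_isOpen hH, hH⟩ ⟨1, H.one_mem⟩)

/-- A connected non-compact Alexandroff paratopological group has no proper open subgroups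
and no proper closed subgroups. -/
theorem no_proper_open_or_closed_subgroups
    (G : Type*) [Group G] [TopologicalSpace G] [AlexandrovDiscrete G] [T0Space G]
    [ContinuousMul G] [ConnectedSpace G] [NoncompactSpace G] (H : Subgroup G) :
    (IsOpen (H : Set G) → H = ⊤) ∧ (IsClosed (H : Set G) → H = ⊤) :=
  ⟨H.eq_top_of_isOpen, fun hH => H.eq_top_of_isOpen (H.isOpen_of_isClosed hH)⟩
end
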